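/- arXiv:2212.14495 — 2 statements merged into one kernel-verified Lean document; each statement's English description precedes it below -/
import Mathlib

section
/- Let C142, C143, C144, C244 be real numbers with C144 ≠ 0. On the 4-dimensional real vector space with basis y1, y2, y3, y4, the skew-symmetric bilinear bracket determined by [y1,y2]=y3, [y1,y3]=y4, [y1,y4]=−(C142·C244/C144)·y1 + C142·y2 + C143·y3 + C144·y4, [y2,y3]=(C244/C144)·y4, [y2,y4]=(C244/C144²)·(−C142·C244·y1 + C142·C144·y2 + C143·C144·y3 + C144²·y4), [y3,y4]=0 satisfies the Jacobi identity (so it defines a Lie algebra, called ourSolDep[3]), and the 2-dimensional subspace D = span{y1,y2} is an Engel-like structure on it. -/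
/-- Bilinear extension of structure constants `c` to a bracket on `Fin 4 → ℝ`. -/
noncomputable def bk (c : Fin 4 → Fin 4 → Fin 4 → ℝ) (x y : Fin 4 → ℝ) : Fin 4 → ℝ :=
  ∑ i : Fin 4, ∑ j : Fin 4, (x i * y j) • c i j

/-- Structure constants of the Engel-normalized bracket:
`[y1,y2] = y3`, `[y1,y3] = y4`, `[y1,y4] = C14`, `[y2,y3] = C23`,
`[y2,y4] = C24`, `[y3,y4] = C34`, extended skew-symmetrically. -/
noncomputable def sc (C14 C23 C24 C34 : Fin 4 → ℝ) : Fin 4 → Fin 4 → Fin 4 → ℝ :=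
  ![![0, ![0, 0, 1, 0], ![0, 0, 0, 1], C14],
    ![-![0, 0, 1, 0], 0, C23, C24],
    ![-![0, 0, 0, 1], -C23, 0, C34],
    ![-C14, -C24, -C34, 0]]

/-- The subspace spanned by all brackets `B u v` with `u ∈ S`, `v ∈ T`. -/
noncomputable def brS (B : (Fin 4 → ℝ) → (Fin 4 → ℝ) → (Fin 4 → ℝ))
    (S T : Submodule ℝ (Fin 4 → ℝ)) : Submodule ℝ (Fin 4 → ℝ) :=
  Submodule.span ℝ {z | ∃ u ∈ S, ∃ v ∈ T, z = B u v}

/-- `D` is an Engel-like structure for the bracket `B`: `D` is 2-dimensional,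
`D[2] = D + [D,D]` is 3-dimensional and `D[3] = D[2] + [D[2],D[2]]` is 4-dimensional. -/
noncomputable def IsEngelLike (B : (Fin 4 → ℝ) → (Fin 4 → ℝ) → (Fin 4 → ℝ))
    (D : Submodule ℝ (Fin 4 → ℝ)) : Prop :=
  Module.finrank ℝ D = 2 ∧
  Module.finrank ℝ ↥(D ⊔ brS B D D) = 3 ∧
  Module.finrank ℝ ↥((D ⊔ brS B D D) ⊔ brS B (D ⊔ brS B D D) (D ⊔ brS B D D)) = 4

theorem bk_formula (a b d k : ℝ) (c : Fin 4 → Fin 4 → Fin 4 → ℝ)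
    (hc : c = sc ![-(a * k), a, b, d] ![0, 0, 0, k]
      ![k * (-(a * k)), k * a, k * b, k * d] ![0, 0, 0, 0]) (x y : Fin 4 → ℝ) :
    bk c x y = ![-(a * k) * ((x 0 * y 3 - x 3 * y 0) + k * (x 1 * y 3 - x 3 * y 1)),
      a * ((x 0 * y 3 - x 3 * y 0) + k * (x 1 * y 3 - x 3 * y 1)),
      (x 0 * y 1 - x 1 * y 0) + b * ((x 0 * y 3 - x 3 * y 0) + k * (x 1 * y 3 - x 3 * y 1)),
      (x 0 * y 2 - x 2 * y 0) + k * (x 1 * y 2 - x 2 * y 1)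
        + d * ((x 0 * y 3 - x 3 * y 0) + k * (x 1 * y 3 - x 3 * y 1))] := by
  subst hc
  ext i
  fin_cases i <;> simp [bk, sc, Fin.sum_univ_four] <;> ring

theorem memD (u : Fin 4 → ℝ) :
    u ∈ Submodule.span ℝ {(![1, 0, 0, 0] : Fin 4 → ℝ), ![0, 1, 0, 0]} ↔ u 2 = 0 ∧ u 3 = 0 := by
  rw [Submodule.mem_span_pair]
  constructor
  · rintro ⟨p, q, rfl⟩
    simp
  · rintro ⟨h2, h3⟩
    refine ⟨u 0, u 1, ?_⟩
    ext i
    fin_cases i <;> simp [h2, h3]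

theorem memE (u : Fin 4 → ℝ) :
    u ∈ Submodule.span ℝ (Set.range ![(![1, 0, 0, 0] : Fin 4 → ℝ), ![0, 1, 0, 0], ![0, 0, 1, 0]])
      ↔ u 3 = 0 := by
  rw [Submodule.mem_span_range_iff_exists_fun]
  constructor
  · rintro ⟨p, rfl⟩
    simp [Fin.sum_univ_three]
  · intro h3
    refine ⟨![u 0, u 1, u 2], ?_⟩
    ext i
    fin_cases i <;> simp [h3, Fin.sum_univ_three]

theorem engel_aux (a b d k : ℝ) (c : Fin 4 → Fin 4 → Fin 4 → ℝ)
    (hc : c = sc ![-(a * k), a, b, d] ![0, 0, 0, k]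
      ![k * (-(a * k)), k * a, k * b, k * d] ![0, 0, 0, 0]) :
    IsEngelLike (bk c)
      (Submodule.span ℝ {(![1, 0, 0, 0] : Fin 4 → ℝ), ![0, 1, 0, 0]}) := by
  have hE : Submodule.span ℝ {(![1, 0, 0, 0] : Fin 4 → ℝ), ![0, 1, 0, 0]} ⊔
      brS (bk c) (Submodule.span ℝ {(![1, 0, 0, 0] : Fin 4 → ℝ), ![0, 1, 0, 0]})
        (Submodule.span ℝ {(![1, 0, 0, 0] : Fin 4 → ℝ), ![0, 1, 0, 0]}) =
      Submodule.span ℝ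
        (Set.range ![(![1, 0, 0, 0] : Fin 4 → ℝ), ![0, 1, 0, 0], ![0, 0, 1, 0]]) := by
    apply le_antisymm
    · apply sup_le
      · intro u hu
        rw [memD] at hu
        rw [memE]
        exact hu.2
      · unfold brS
        rw [Submodule.span_le]
        rintro z ⟨u, hu, v, hv, rfl⟩
        rw [memD] at hu hv
        rw [SetLike.mem_coe, memE, bk_formula a b d k c hc]
        simp [hu, hv]
    · rw [Submodule.span_le]
      rintro z ⟨i, rfl⟩
      fin_cases i
      · exact Submodule.mem_sup_left ((memD _).2 (by simp))
      · exact Submodule.mem_sup_left ((memD _).2 (by simp))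
      · refine Submodule.mem_sup_right (Submodule.subset_span
          ⟨![1, 0, 0, 0], (memD _).2 (by simp), ![0, 1, 0, 0], (memD _).2 (by simp), ?_⟩)
        rw [bk_formula a b d k c hc]
        simp
  unfold IsEngelLike
  rw [hE]
  refine ⟨?_, ?_, ?_⟩
  · have h : LinearIndependent ℝ ![(![1, 0, 0, 0] : Fin 4 → ℝ), ![0, 1, 0, 0]] := by
      rw [LinearIndependent.pair_iff]
      intro s t h
      have h0 := congrFun h 0
      have h1 := congrFun h 1
      simp at h0 h1
      exact ⟨h0, h1⟩
    have := finrank_span_eq_card h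
    rw [Matrix.range_cons_cons_empty] at this
    simpa using this
  · have h : LinearIndependent ℝ
        ![(![1, 0, 0, 0] : Fin 4 → ℝ), ![0, 1, 0, 0], ![0, 0, 1, 0]] := by
      rw [Fintype.linearIndependent_iff]
      intro g h
      have h0 := congrFun h 0
      have h1 := congrFun h 1
      have h2 := congrFun h 2
      simp [Fin.sum_univ_three] at h0 h1 h2
      intro i
      fin_cases i <;> simp [h0, h1, h2]
    have := finrank_span_eq_card h
    simpa using this
  · have key : ∀ S : Submodule ℝ (Fin 4 → ℝ), (∀ u, u ∈ S) → Module.finrank ℝ S = 4 := by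
      intro S hS
      rw [(Submodule.eq_top_iff').2 hS]
      simp
    apply key
    · intro u
      have hu : u = ![u 0, u 1, u 2, 0] + u 3 • ![0, 0, 0, 1] := by
        ext i
        fin_cases i <;> simp
      rw [hu]
      refine Submodule.add_mem _ (Submodule.mem_sup_left ((memE _).2 (by simp)))
        (Submodule.smul_mem _ _ (Submodule.mem_sup_right (Submodule.subset_span
          ⟨![1, 0, 0, 0], (memE _).2 (by simp), ![0, 0, 1, 0], (memE _).2 (by simp), ?_⟩)))
      rw [bk_formula a b d k c hc]
      simp

theorem ourSolDep3_lie_and_engel (C142 C143 C144 C244 : ℝ)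
    (hC144 : C144 ≠ 0) :
    let c := sc ![-(C142 * C244 / C144), C142, C143, C144]
      ![0, 0, 0, C244 / C144]
      ![(C244 / C144 ^ 2) * (-C142 * C244), (C244 / C144 ^ 2) * (C142 * C144),
        (C244 / C144 ^ 2) * (C143 * C144), (C244 / C144 ^ 2) * C144 ^ 2]
      ![0, 0, 0, 0]
    (∀ x y : Fin 4 → ℝ, bk c x y = -bk c y x) ∧
    (∀ x y z : Fin 4 → ℝ,
      bk c x (bk c y z) + bk c y (bk c z x) + bk c z (bk c x y) = 0) ∧
    IsEngelLike (bk c)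
      (Submodule.span ℝ {(![1, 0, 0, 0] : Fin 4 → ℝ), ![0, 1, 0, 0]}) := by
  intro c
  have hc : c = sc ![-(C142 * (C244 / C144)), C142, C143, C144] ![0, 0, 0, C244 / C144]
      ![C244 / C144 * (-(C142 * (C244 / C144))), C244 / C144 * C142, C244 / C144 * C143,
        C244 / C144 * C144] ![0, 0, 0, 0] := by
    have e1 : -(C142 * C244 / C144) = -(C142 * (C244 / C144)) := by ring
    have e2 : (C244 / C144 ^ 2) * (-C142 * C244) = C244 / C144 * (-(C142 * (C244 / C144))) := by
      field_simp
    have e3 : (C244 / C144 ^ 2) * (C142 * C144) = C244 / C144 * C142 := by field_simp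
    have e4 : (C244 / C144 ^ 2) * (C143 * C144) = C244 / C144 * C143 := by field_simp
    have e5 : (C244 / C144 ^ 2) * C144 ^ 2 = C244 / C144 * C144 := by field_simp
    simp only [c, e1, e2, e3, e4, e5]
  clear_value c
  generalize C244 / C144 = k at hc
  refine ⟨fun x y => ?_, fun x y z => ?_, engel_aux _ _ _ _ c hc⟩
  · rw [bk_formula _ _ _ _ c hc x y, bk_formula _ _ _ _ c hc y x]
    ext i
    fin_cases i <;> simp <;> ring
  · simp only [bk_formula _ _ _ _ c hc]
    ext i
    fin_cases i <;> simp <;> ring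
end

section
/- Let C143, C144, C234, C244 be arbitrary real numbers and let g be the Lie algebra ourSolDep[1] on the basis y1, y2, y3, y4 with brackets [y1,y2]=y3, [y1,y3]=y4, [y1,y4]=C143·y3 + C144·y4, [y2,y3]=(−C144·C234 + C244)·y3 + C234·y4, [y2,y4]=C143·C234·y3 + C244·y4, [y3,y4]=0. Let D = span{y1,y2}, so that D[2] := D + [D,D] = span{y1,y2,y3}, and let L = span{C234·y1 − y2}. Then L ⊆ D and [L, D[2]] ⊆ D[2], i.e. L is a characteristic line of the Engel-like structure D. -/
theorem memD_iff (x : Fin 4 → ℝ) :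
    x ∈ Submodule.span ℝ {(![1, 0, 0, 0] : Fin 4 → ℝ), ![0, 1, 0, 0]} ↔ x 2 = 0 ∧ x 3 = 0 := by
  rw [Submodule.mem_span_pair]
  constructor
  · rintro ⟨a, b, rfl⟩
    simp
  · rintro ⟨h2, h3⟩
    refine ⟨x 0, x 1, ?_⟩
    ext i
    fin_cases i <;> simp [h2, h3]

theorem memE_iff (x : Fin 4 → ℝ) :
    x ∈ Submodule.span ℝ {(![1, 0, 0, 0] : Fin 4 → ℝ), ![0, 1, 0, 0], ![0, 0, 1, 0]} ↔
      x 3 = 0 := by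
  rw [Submodule.mem_span_triple]
  constructor
  · rintro ⟨a, b, c, rfl⟩
    simp
  · rintro h3
    refine ⟨x 0, x 1, x 2, ?_⟩
    ext i
    fin_cases i <;> simp [h3]

theorem ourSolDep1_characteristic_line (C143 C144 C234 C244 : ℝ) :
    let B := bk (sc ![0, 0, C143, C144]
      ![0, 0, -C144 * C234 + C244, C234]
      ![0, 0, C143 * C234, C244]
      ![0, 0, 0, 0])
    let D := Submodule.span ℝ {(![1, 0, 0, 0] : Fin 4 → ℝ), ![0, 1, 0, 0]}
    let D2 := D ⊔ brS B D D
    let Lc := Submodule.span ℝ {(![C234, -1, 0, 0] : Fin 4 → ℝ)}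
    D2 = Submodule.span ℝ {(![1, 0, 0, 0] : Fin 4 → ℝ), ![0, 1, 0, 0], ![0, 0, 1, 0]} ∧
    Module.finrank ℝ Lc = 1 ∧ Lc ≤ D ∧ brS B Lc D2 ≤ D2 := by
  intro B D D2 Lc
  have hD2 : D2 = Submodule.span ℝ
      {(![1, 0, 0, 0] : Fin 4 → ℝ), ![0, 1, 0, 0], ![0, 0, 1, 0]} := by
    apply le_antisymm
    · refine sup_le ?_ (Submodule.span_le.2 ?_)
      · intro x hx
        exact (memE_iff x).2 ((memD_iff x).1 hx).2
      · rintro z ⟨u, hu, v, hv, rfl⟩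
        obtain ⟨hu2, hu3⟩ := (memD_iff u).1 hu
        obtain ⟨hv2, hv3⟩ := (memD_iff v).1 hv
        refine (memE_iff _).2 ?_
        simp [B, bk, sc, Fin.sum_univ_four, hu2, hu3, hv2, hv3]
    · rw [Submodule.span_le]
      have h1 : (![1, 0, 0, 0] : Fin 4 → ℝ) ∈ D := (memD_iff _).2 (by simp)
      have h2 : (![0, 1, 0, 0] : Fin 4 → ℝ) ∈ D := (memD_iff _).2 (by simp)
      rintro z (rfl | rfl | rfl)
      · exact Submodule.mem_sup_left h1
      · exact Submodule.mem_sup_left h2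
      · refine Submodule.mem_sup_right (Submodule.subset_span ⟨_, h1, _, h2, ?_⟩)
        ext i
        fin_cases i <;> simp [B, bk, sc, Fin.sum_univ_four]
  refine ⟨hD2, ?_, ?_, ?_⟩
  · apply finrank_span_singleton
    intro h
    have := congrFun h 1
    simp at this
  · refine Submodule.span_le.2 ?_
    rintro z rfl
    exact (memD_iff _).2 (by simp)
  · refine Submodule.span_le.2 ?_
    rintro z ⟨u, hu, v, hv, rfl⟩
    rw [hD2] at hv ⊢
    have hv3 := (memE_iff v).1 hv
    obtain ⟨a, rfl⟩ := Submodule.mem_span_singleton.1 hu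
    refine (memE_iff _).2 ?_
    simp [B, bk, sc, Fin.sum_univ_four, hv3]
    try ring
end
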